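/- Let P, S ∈ 𝕂[X₁,…,Xₙ,U₁,…,Uₙ], g = E(S), T = Z(g) ⊆ ℝⁿ. Assume T ⊆ Z(E(P)), dim T = n−1, and there exists a real algebraic set B over 𝕂 with dim B = n−1 and T_{n−1} ⊆ B. Then: (i) (T \ W_S)_{n−1} × ℝⁿ ⊆ Z(S), i.e., S(x,u) = 0 for every x ∈ T \ W_S with dim_x(T \ W_S) = n−1 and every u ∈ ℝⁿ; (ii) (T \ (W_P ∪ W_S))_{n−1} × ℝⁿ ⊆ Z(P) ∩ Z(S); (iii) ((T ∩ W_S) \ W_P)_{n−1} × ℝⁿ ⊆ Z(P). -/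

import Mathlib

open MeasureTheory Set
open scoped ENNReal

noncomputable section

/-- `K` is a real algebraic extension of `ℚ`: every element of `K` is algebraic over `ℚ`. -/
def RealAlgExt (K : Subfield ℝ) : Prop := ∀ a : K, IsAlgebraic ℚ (a : ℝ)

/-- A real polynomial has all its coefficients in the subfield `K` of `ℝ`. -/
def CoeffsIn {σ : Type*} (K : Subfield ℝ) (P : MvPolynomial σ ℝ) : Prop :=
  ∀ m, P.coeff m ∈ K

/-- Evaluation of a polynomial in `X₁,…,Xₙ,U₁,…,Uₙ` at `(x, e^x)`:
the E-polynomial associated to `P`. -/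
def expEval {n : ℕ} (P : MvPolynomial (Fin n ⊕ Fin n) ℝ) (x : Fin n → ℝ) : ℝ :=
  MvPolynomial.eval (Sum.elim x fun i => Real.exp (x i)) P

/-- Exponential sets over `K` in `ℝⁿ`: zero sets of E-polynomials over `K`. -/
def IsExpSet {n : ℕ} (K : Subfield ℝ) (V : Set (Fin n → ℝ)) : Prop :=
  ∃ P : MvPolynomial (Fin n ⊕ Fin n) ℝ, CoeffsIn K P ∧ V = {x | expEval P x = 0}

/-- Real algebraic sets over `K` (in coordinates indexed by `σ`). -/
def IsAlgSet {σ : Type*} (K : Subfield ℝ) (S : Set (σ → ℝ)) : Prop :=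
  ∃ P : MvPolynomial σ ℝ, CoeffsIn K P ∧ S = {x | MvPolynomial.eval x P = 0}

/-- An exponential set is irreducible if it is nonempty and is not the union of
two proper exponential subsets. -/
def IsIrredExpSet {n : ℕ} (K : Subfield ℝ) (V : Set (Fin n → ℝ)) : Prop :=
  IsExpSet K V ∧ V.Nonempty ∧
    ¬ ∃ V₁ V₂ : Set (Fin n → ℝ),
      IsExpSet K V₁ ∧ IsExpSet K V₂ ∧ V = V₁ ∪ V₂ ∧ V₁ ⊂ V ∧ V₂ ⊂ V

/-- `T` is an irreducible component of `V`: a maximal irreducible exponential subset of `V`. -/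
def IsExpComponent {n : ℕ} (K : Subfield ℝ) (T V : Set (Fin n → ℝ)) : Prop :=
  IsIrredExpSet K T ∧ T ⊆ V ∧
    ∀ T', IsIrredExpSet K T' → T ⊆ T' → T' ⊆ V → T' = T

/-- A real algebraic set is irreducible over `K` if it is nonempty and is not the union of
two proper algebraic subsets over `K`. -/
def IsIrredAlgSet {σ : Type*} (K : Subfield ℝ) (V : Set (σ → ℝ)) : Prop :=
  IsAlgSet K V ∧ V.Nonempty ∧
    ¬ ∃ V₁ V₂ : Set (σ → ℝ),
      IsAlgSet K V₁ ∧ IsAlgSet K V₂ ∧ V = V₁ ∪ V₂ ∧ V₁ ⊂ V ∧ V₂ ⊂ V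

/-- `T` is an irreducible component over `K` of the real algebraic set `V`. -/
def IsAlgComponent {σ : Type*} (K : Subfield ℝ) (T V : Set (σ → ℝ)) : Prop :=
  IsIrredAlgSet K T ∧ T ⊆ V ∧
    ∀ T', IsIrredAlgSet K T' → T ⊆ T' → T' ⊆ V → T' = T

/-- Local (Hausdorff) dimension of `A` at `x`. -/
def locDim {n : ℕ} (A : Set (Fin n → ℝ)) (x : Fin n → ℝ) : ℝ≥0∞ :=
  ⨅ (ε : ℝ) (_ : 0 < ε), dimH (A ∩ Metric.ball x ε)

/-- `A_p`: the set of points of `A` at which `A` has local dimension `p`. -/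
def localSet {n : ℕ} (A : Set (Fin n → ℝ)) (p : ℕ) : Set (Fin n → ℝ) :=
  {x | x ∈ A ∧ locDim A x = (p : ℝ≥0∞)}

/-- The exponent vectors of the `U`-monomials of `P` (with nonzero coefficient in `𝕂[X]`). -/
def Uexps {n : ℕ} (P : MvPolynomial (Fin n ⊕ Fin n) ℝ) : Set (Fin n → ℕ) :=
  (fun (m : (Fin n ⊕ Fin n) →₀ ℕ) (i : Fin n) => m (Sum.inr i)) '' (P.support : Set _)

/-- The union `W_P` of the linear hyperplane sets associated to pairs of distinct
`U`-monomials of `P`. -/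
def WP {n : ℕ} (P : MvPolynomial (Fin n ⊕ Fin n) ℝ) : Set (Fin n → ℝ) :=
  {x | ∃ d e : Fin n → ℕ, d ∈ Uexps P ∧ e ∈ Uexps P ∧ d ≠ e ∧
    ∑ i, (d i : ℝ) * x i = ∑ i, (e i : ℝ) * x i}

/-- Schanuel's conjecture over the reals, with "the transcendence degree of
`ℚ(x₁,…,xₙ,e^{x₁},…,e^{xₙ})` over `ℚ` is less than `n`" expressed as: no `n`-tuple of
elements of `{x₁,…,xₙ,e^{x₁},…,e^{xₙ}}` is algebraically independent over `ℚ`. -/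
def SchanuelConjecture : Prop :=
  ∀ (n : ℕ) (x : Fin n → ℝ),
    (¬ ∃ v : Fin n → ℝ,
        (∀ i, v i ∈ Set.range x ∪ Set.range fun j => Real.exp (x j)) ∧
        AlgebraicIndependent ℚ v) →
    ∃ m : Fin n → ℤ, (∃ i, m i ≠ 0) ∧ ∑ i, (m i : ℝ) * x i = 0

section LindemannWeierstrass

open Polynomial

/-- A common multiple making finitely many elements of a number field integral, as a natural
number. -/
theorem exists_nat_ne_zero_forall_isIntegral_mul {L : Type*} [Field L] [NumberField L]
    (s : Finset L) : ∃ M : ℕ, M ≠ 0 ∧ ∀ a ∈ s, IsIntegral ℤ ((M : L) * a) := by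
  obtain ⟨y, hy, h⟩ := exists_integral_multiples ℤ ℚ s
  refine ⟨y.natAbs, by simpa using hy, fun a ha => ?_⟩
  have h' := h a ha
  rw [zsmul_eq_mul] at h'
  rcases Int.natAbs_eq y with e | e
  · rw [e] at h'
    simpa using h'
  · rw [e] at h'
    simpa using h'.neg

/-- If `M * a` is integral and `D` bounds the degree of `g ∈ ℤ[X]` then `M ^ D * g(a)` is
integral. -/
theorem isIntegral_pow_mul_aeval {L : Type*} [Field L] {M : ℕ} {a : L}
    (h : IsIntegral ℤ ((M : L) * a)) (g : ℤ[X]) {D : ℕ} (hD : g.natDegree ≤ D) :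
    IsIntegral ℤ ((M : L) ^ D * aeval a g) := by
  rw [aeval_eq_sum_range' (Nat.lt_succ_of_le hD), Finset.mul_sum]
  refine IsIntegral.sum _ fun k hk => ?_
  have hk' : k ≤ D := Nat.lt_succ_iff.mp (Finset.mem_range.mp hk)
  have e : (M : L) ^ D * g.coeff k • a ^ k
      = ((g.coeff k * (M : ℤ) ^ (D - k) : ℤ) : L) * ((M : L) * a) ^ k := by
    have : (M : L) ^ D = M ^ (D - k) * M ^ k := by rw [← pow_add, Nat.sub_add_cancel hk']
    rw [zsmul_eq_mul, this]
    push_cast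
    ring
  rw [e]
  exact (isIntegral_algebraMap (x := (g.coeff k * (M : ℤ) ^ (D - k) : ℤ))).mul (h.pow k)

/-- A nonzero `a` with `M * a` integral is a root of an integral polynomial not vanishing at
`0`. -/
theorem exists_int_poly_root_eval_zero_ne_zero {L : Type*} [Field L] [CharZero L] {M : ℕ}
    (hM : M ≠ 0) {a : L} (ha : a ≠ 0) (h : IsIntegral ℤ ((M : L) * a)) :
    ∃ f : ℤ[X], f.eval 0 ≠ 0 ∧ aeval a f = 0 := by
  refine ⟨(minpoly ℤ ((M : L) * a)).comp (C (M : ℤ) * X), ?_, ?_⟩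
  · rw [eval_comp]
    simp only [eval_mul, eval_C, eval_X, mul_zero]
    rw [← coeff_zero_eq_eval_zero]
    intro h0
    have h1 := minpoly.coeff_zero_ne_zero (A := ℚ) (h.tower_top (A := ℚ))
      (mul_ne_zero (Nat.cast_ne_zero.mpr hM) ha)
    rw [minpoly.isIntegrallyClosed_eq_field_fractions' ℚ h, coeff_map, h0, map_zero] at h1
    exact h1 rfl
  · simp [aeval_comp, minpoly.aeval]

theorem exists_int_eq_of_isIntegral_of_fixed {L : Type*} [Field L] [NumberField L] [IsGalois ℚ L]
    {x : L} (hx : IsIntegral ℤ x) (hfix : ∀ σ : L ≃ₐ[ℚ] L, σ x = x) : ∃ j : ℤ, (j : L) = x := by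
  obtain ⟨q, rfl⟩ := (IsGalois.mem_range_algebraMap_iff_fixed x).mpr hfix
  have hq : IsIntegral ℤ q := (isIntegral_algebraMap_iff (algebraMap ℚ L).injective).mp hx
  obtain ⟨j, rfl⟩ := IsIntegrallyClosed.isIntegral_iff.mp hq
  exact ⟨j, by simp⟩

open scoped Nat in
/-- Core of the Lindemann–Weierstrass theorem: a Galois-equivariant exponential sum with nonzero
coefficient at `0` does not vanish. -/
theorem sum_mul_exp_ne_zero_of_equivariant {L : Type*} [Field L] [NumberField L] [IsGalois ℚ L]
    (ψ : L →+* ℂ) (z : L →₀ L) (hz : ∀ (σ : L ≃ₐ[ℚ] L) a, z (σ a) = σ (z a)) (h0 : z 0 ≠ 0) :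
    (z.sum fun a c => ψ c * Complex.exp (ψ a)) ≠ 0 := by
  classical
  intro hsum
  obtain ⟨M, hM, hMint⟩ :=
    exists_nat_ne_zero_forall_isIntegral_mul (z.support ∪ z.support.image z)
  have hML : (M : L) ≠ 0 := Nat.cast_ne_zero.mpr hM
  have hMa : ∀ a ∈ z.support, IsIntegral ℤ ((M : L) * a) := fun a ha =>
    hMint a (Finset.mem_union_left _ ha)
  have hMz : ∀ a ∈ z.support, IsIntegral ℤ ((M : L) * z a) := fun a ha =>
    hMint _ (Finset.mem_union_right _ (Finset.mem_image_of_mem z ha))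
  have h0s : (0 : L) ∈ z.support := Finsupp.mem_support_iff.mpr h0
  set s := z.support.erase 0 with hs
  have hroot : ∀ a : L, ∃ f : ℤ[X], a ∈ s → f.eval 0 ≠ 0 ∧ aeval a f = 0 := by
    intro a
    by_cases ha : a ∈ s
    · obtain ⟨f, hf⟩ := exists_int_poly_root_eval_zero_ne_zero hM (Finset.ne_of_mem_erase ha)
        (hMa a (Finset.mem_of_mem_erase ha))
      exact ⟨f, fun _ => hf⟩
    · exact ⟨0, fun h => absurd h ha⟩
  choose F hF using hroot
  set f : ℤ[X] := ∏ a ∈ s, F a with hf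
  have hf0 : f.eval 0 ≠ 0 := by
    rw [hf, eval_prod]
    exact Finset.prod_ne_zero_iff.mpr fun a ha => (hF a ha).1
  have hfne : f ≠ 0 := fun h => hf0 (by simp [h])
  have hfroot : ∀ a ∈ s, ψ a ∈ f.aroots ℂ := by
    intro a ha
    rw [mem_aroots]
    refine ⟨hfne, ?_⟩
    have h1 : aeval a f = 0 := by
      rw [hf, map_prod]
      exact Finset.prod_eq_zero ha (hF a ha).2
    exact (aeval_algHom_apply ψ.toIntAlgHom a f).trans (by simp [h1])
  obtain ⟨b0, hb0⟩ := exists_int_eq_of_isIntegral_of_fixed (hMz 0 h0s) (fun σ => by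
    have := hz σ 0
    rw [map_zero] at this
    rw [map_mul, map_natCast, ← this])
  have hb0ne : b0 ≠ 0 := by
    rintro rfl
    simp only [Int.cast_zero] at hb0
    exact mul_ne_zero hML h0 hb0.symm
  obtain ⟨c, hc⟩ := LindemannWeierstrass.exp_polynomial_approx f hf0
  set d := f.natDegree with hd
  set A : ℝ := ∑ a ∈ s, ‖ψ (M * z a)‖ with hA
  have hA0 : 0 ≤ A := Finset.sum_nonneg fun _ _ => norm_nonneg _
  have key : ∀ p : ℕ, p.Prime → (eval 0 f).natAbs < p → b0.natAbs < p → M < p →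
      1 ≤ (A * ((M : ℝ) ^ d * |c|)) * (((M : ℝ) ^ d * |c|) ^ (p - 1) / (p - 1)!) := by
    intro p hp hpf hpb hpM
    obtain ⟨n, hn, g, hg, happ⟩ := hc p hpf hp
    have hgD : g.natDegree ≤ p * d := hg.trans (Nat.sub_le _ _)
    set J : L := ∑ a ∈ s, (M * z a) * ((M : L) ^ (p * d) * aeval a g) with hJ
    have hJint : IsIntegral ℤ J := IsIntegral.sum _ fun a ha =>
      (hMz a (Finset.mem_of_mem_erase ha)).mul
        (isIntegral_pow_mul_aeval (hMa a (Finset.mem_of_mem_erase ha)) g hgD)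
    have hJfix : ∀ σ : L ≃ₐ[ℚ] L, σ J = J := by
      intro σ
      rw [hJ, map_sum]
      refine Finset.sum_bij (fun a _ => σ a) ?_ (fun _ _ _ _ h => σ.injective h) ?_ ?_
      · intro a ha
        rw [hs, Finset.mem_erase, Finsupp.mem_support_iff] at ha ⊢
        rw [hz]
        exact ⟨(map_ne_zero σ).mpr ha.1, (map_ne_zero σ).mpr ha.2⟩
      · intro a ha
        refine ⟨σ.symm a, ?_, by simp⟩
        rw [hs, Finset.mem_erase, Finsupp.mem_support_iff] at ha ⊢
        rw [hz]
        exact ⟨(map_ne_zero σ.symm).mpr ha.1, (map_ne_zero σ.symm).mpr ha.2⟩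
      · intro a _
        have : σ (aeval a g) = aeval (σ a) g := by
          have := aeval_algHom_apply ((σ : L →ₐ[ℚ] L).restrictScalars ℤ) a g
          simpa using this.symm
        rw [hz]
        simp only [map_mul, map_pow, map_natCast, this]
    obtain ⟨j, hj⟩ := exists_int_eq_of_isIntegral_of_fixed hJint hJfix
    have hsplit : ψ (M * z 0) + ∑ a ∈ s, ψ (M * z a) * Complex.exp (ψ a) = 0 := by
      have h1 : ∑ a ∈ z.support, ψ (z a) * Complex.exp (ψ a) = 0 := hsum
      rw [← Finset.add_sum_erase _ _ h0s] at h1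
      have h2 := congrArg (fun t => (M : ℂ) * t) h1
      simp only [map_zero, Complex.exp_zero, mul_one, mul_zero, mul_add, Finset.mul_sum] at h2
      simpa only [map_mul, map_natCast, mul_assoc] using h2
    have haev : ∀ a : L, ψ (aeval a g) = aeval (ψ a) g := fun a =>
      (aeval_algHom_apply ψ.toIntAlgHom a g).symm
    have hid : (((M : ℤ) ^ (p * d) * n * b0 + p * j : ℤ) : ℂ)
        = -((M : ℂ) ^ (p * d) *
          ∑ a ∈ s, ψ (M * z a) * (n • Complex.exp (ψ a) - p • aeval (ψ a) g)) := by
      have e1 : (b0 : ℂ) = ψ (M * z 0) := by rw [← hb0, map_intCast]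
      have e2 : (j : ℂ) = ∑ a ∈ s, ψ (M * z a) * ((M : ℂ) ^ (p * d) * aeval (ψ a) g) := by
        rw [← map_intCast ψ, hj, hJ, map_sum]
        refine Finset.sum_congr rfl fun a _ => ?_
        rw [map_mul, map_mul _ (_ ^ _), map_pow, map_natCast, haev]
      push_cast
      rw [e1, e2, eq_neg_of_add_eq_zero_left hsplit]
      simp only [zsmul_eq_mul, nsmul_eq_mul, mul_sub, Finset.sum_sub_distrib, Finset.mul_sum,
        mul_neg, neg_sub]
      rw [sub_eq_neg_add, ← Finset.sum_neg_distrib, ← Finset.sum_neg_distrib]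
      congr 1
      · exact Finset.sum_congr rfl fun a _ => by ring
      · exact Finset.sum_congr rfl fun a _ => by ring
    have hne : ((M : ℤ) ^ (p * d) * n * b0 + p * j : ℤ) ≠ 0 := by
      intro h
      have hpp : Prime (p : ℤ) := Nat.prime_iff_prime_int.mp hp
      have hdvd : (p : ℤ) ∣ (M : ℤ) ^ (p * d) * n * b0 :=
        (dvd_add_left (dvd_mul_right (p : ℤ) j)).mp (h ▸ dvd_zero _)
      rcases hpp.dvd_or_dvd hdvd with h1 | h1
      · rcases hpp.dvd_or_dvd h1 with h2 | h2
        · have h3 := hpp.dvd_of_dvd_pow h2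
          exact absurd (Nat.le_of_dvd (Nat.pos_of_ne_zero hM) (Int.natCast_dvd_natCast.mp h3))
            (not_le.mpr hpM)
        · exact hn h2
      · exact absurd (Nat.le_of_dvd (Int.natAbs_pos.mpr hb0ne) (Int.natCast_dvd.mp h1))
          (not_le.mpr hpb)
    have hone : (1 : ℝ) ≤ ‖(((M : ℤ) ^ (p * d) * n * b0 + p * j : ℤ) : ℂ)‖ := by
      rw [Complex.norm_intCast]
      exact_mod_cast Int.one_le_abs hne
    refine hone.trans ?_
    rw [hid, norm_neg, norm_mul, norm_pow, Complex.norm_natCast]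
    have hfac : (0 : ℝ) < (p - 1)! := Nat.cast_pos.mpr (Nat.factorial_pos _)
    have hbound : ‖∑ a ∈ s, ψ (M * z a) * (n • Complex.exp (ψ a) - p • aeval (ψ a) g)‖
        ≤ A * (|c| ^ p / (p - 1)!) := by
      rw [hA, Finset.sum_mul]
      refine (norm_sum_le _ _).trans (Finset.sum_le_sum fun a ha => ?_)
      rw [norm_mul]
      refine mul_le_mul_of_nonneg_left ((happ (hfroot a ha)).trans ?_) (norm_nonneg _)
      refine div_le_div_of_nonneg_right ?_ hfac.le
      rw [← abs_pow]
      exact le_abs_self _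
    refine (mul_le_mul_of_nonneg_left hbound (by positivity)).trans_eq ?_
    obtain ⟨q, rfl⟩ : ∃ q, p = q + 1 := ⟨p - 1, (Nat.succ_pred_prime hp).symm⟩
    simp only [Nat.add_sub_cancel]
    rw [mul_comm (q + 1) d, pow_mul]
    field_simp
    ring
  have hlim := (FloorSemiring.tendsto_pow_div_factorial_atTop ((M : ℝ) ^ d * |c|)).const_mul
    (A * ((M : ℝ) ^ d * |c|))
  rw [mul_zero] at hlim
  obtain ⟨N, hN⟩ := Filter.eventually_atTop.mp (hlim.eventually (gt_mem_nhds one_pos))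
  obtain ⟨p, hp1, hp⟩ :=
    Nat.exists_infinite_primes ((eval 0 f).natAbs + b0.natAbs + M + N + 1)
  exact absurd (key p hp (by omega) (by omega) (by omega)) (not_le.mpr (hN (p - 1) (by omega)))


/-- The diagonal action of a field endomorphism on coefficients and exponents of the group algebra
of the additive group of a field. -/
def diagRingHom {L : Type*} [Field L] (σ : L →+* L) :
    AddMonoidAlgebra L L →+* AddMonoidAlgebra L L :=
  (AddMonoidAlgebra.mapRingHom L σ).comp (AddMonoidAlgebra.mapDomainRingHom L (σ : L →+ L))

theorem diagRingHom_single {L : Type*} [Field L] (σ : L →+* L) (a c : L) :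
    diagRingHom σ (AddMonoidAlgebra.single a c) = AddMonoidAlgebra.single (σ a) (σ c) := by
  simp [diagRingHom]

theorem coeff_diagRingHom {L : Type*} [Field L] (σ : L →+* L) (x : AddMonoidAlgebra L L) (a : L) :
    (diagRingHom σ x).coeff (σ a) = σ (x.coeff a) := by
  simp only [diagRingHom, RingHom.comp_apply, AddMonoidAlgebra.coeff_mapRingHom]
  congr 1
  exact Finsupp.mapDomain_apply σ.injective _ _

theorem diagRingHom_injective {L : Type*} [Field L] (σ : L →+* L) :
    Function.Injective (diagRingHom σ) := by
  refine (injective_iff_map_eq_zero _).mpr fun x hx => ?_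
  ext a
  have h := coeff_diagRingHom σ x a
  rw [hx] at h
  simpa using h.symm

theorem diagRingHom_comp {L : Type*} [Field L] (σ τ : L →+* L) (x : AddMonoidAlgebra L L) :
    diagRingHom σ (diagRingHom τ x) = diagRingHom (σ.comp τ) x := by
  induction x using AddMonoidAlgebra.induction_linear with
  | zero => simp
  | add x y hx hy => simp [hx, hy]
  | single a c => simp [diagRingHom_single]

theorem diagRingHom_id {L : Type*} [Field L] (x : AddMonoidAlgebra L L) :
    diagRingHom (RingHom.id L) x = x := by
  induction x using AddMonoidAlgebra.induction_linear with
  | zero => simp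
  | add x y hx hy => simp [hx, hy]
  | single a c => simp [diagRingHom_single]

/-- The exponential evaluation `∑ c [a] ↦ ∑ ψ(c) e^{ψ(a)}` of the group algebra. -/
def expEvalRingHom {L : Type*} [Field L] (ψ : L →+* ℂ) : AddMonoidAlgebra L L →+* ℂ :=
  AddMonoidAlgebra.liftNCRingHom ψ
    (Complex.expMonoidHom.comp (AddMonoidHom.toMultiplicative (ψ : L →+ ℂ)))
    fun _ _ => Commute.all _ _

theorem expEvalRingHom_single {L : Type*} [Field L] (ψ : L →+* ℂ) (a c : L) :
    expEvalRingHom ψ (AddMonoidAlgebra.single a c) = ψ c * Complex.exp (ψ a) :=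
  AddMonoidAlgebra.liftNC_single _ _ _ _

theorem expEvalRingHom_apply {L : Type*} [Field L] (ψ : L →+* ℂ) (x : AddMonoidAlgebra L L) :
    expEvalRingHom ψ x = x.coeff.sum fun a c => ψ c * Complex.exp (ψ a) := by
  conv_lhs => rw [← AddMonoidAlgebra.sum_coeff_single x]
  rw [Finsupp.sum, map_sum]
  exact Finset.sum_congr rfl fun a _ => expEvalRingHom_single ψ a _

theorem expEvalRingHom_injective {L : Type*} [Field L] [NumberField L] [IsGalois ℚ L]
    (ψ : L →+* ℂ) : Function.Injective (expEvalRingHom ψ) := by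
  refine (injective_iff_map_eq_zero _).mpr fun x hx => ?_
  by_contra hx0
  let Θ : (L ≃ₐ[ℚ] L) → AddMonoidAlgebra L L →+* AddMonoidAlgebra L L := fun σ =>
    diagRingHom (σ : L →+* L)
  have hΘ : ∀ σ τ y, Θ σ (Θ τ y) = Θ (σ * τ) y := fun σ τ y => diagRingHom_comp _ _ _
  set z := ∏ σ : L ≃ₐ[ℚ] L, Θ σ x with hz
  have hz0 : z ≠ 0 := Finset.prod_ne_zero_iff.mpr fun σ _ =>
    (map_ne_zero_iff _ (diagRingHom_injective _)).mpr hx0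
  have hzev : expEvalRingHom ψ z = 0 := by
    rw [hz, map_prod]
    refine Finset.prod_eq_zero (Finset.mem_univ 1) ?_
    have : Θ 1 x = x := diagRingHom_id x
    rw [this, hx]
  have hzinv : ∀ τ, Θ τ z = z := by
    intro τ
    rw [hz, map_prod]
    simp only [hΘ]
    exact (Group.mulLeft_bijective τ).prod_comp fun σ => Θ σ x
  have hzc : ∀ (σ : L ≃ₐ[ℚ] L) a, z.coeff (σ a) = σ (z.coeff a) := by
    intro σ a
    conv_lhs => rw [← hzinv σ]
    exact coeff_diagRingHom _ _ _
  obtain ⟨α, hα⟩ : ∃ α, z.coeff α ≠ 0 := by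
    by_contra! h
    exact hz0 (AddMonoidAlgebra.ext (Finsupp.ext h))
  set m := ∑ σ : L ≃ₐ[ℚ] L, AddMonoidAlgebra.single (-σ α) (σ (z.coeff α)⁻¹) with hm
  have hminv : ∀ τ, Θ τ m = m := by
    intro τ
    rw [hm, map_sum]
    have : ∀ σ : L ≃ₐ[ℚ] L, Θ τ (AddMonoidAlgebra.single (-σ α) (σ (z.coeff α)⁻¹))
        = AddMonoidAlgebra.single (-(τ * σ) α) ((τ * σ) (z.coeff α)⁻¹) := by
      intro σ
      simp [Θ, diagRingHom_single]
    simp only [this]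
    exact (Group.mulLeft_bijective τ).sum_comp fun σ : L ≃ₐ[ℚ] L =>
      AddMonoidAlgebra.single (-σ α) (σ (z.coeff α)⁻¹)
  refine sum_mul_exp_ne_zero_of_equivariant ψ (z * m).coeff ?_ ?_ ?_
  · intro σ a
    have : Θ σ (z * m) = z * m := by rw [map_mul, hzinv, hminv]
    conv_lhs => rw [← this]
    exact coeff_diagRingHom _ _ _
  · have : (z * m).coeff 0 = Fintype.card (L ≃ₐ[ℚ] L) := by
      rw [hm, Finset.mul_sum, AddMonoidAlgebra.coeff_sum, Finsupp.finsetSum_apply]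
      have h1 : ∀ σ : L ≃ₐ[ℚ] L,
          (z * AddMonoidAlgebra.single (-σ α) (σ (z.coeff α)⁻¹)).coeff 0 = 1 := by
        intro σ
        rw [AddMonoidAlgebra.coeff_mul_single_eq_coeff_mul (σ α)
          (fun a _ => by rw [add_neg_eq_zero]), hzc, ← map_mul, mul_inv_cancel₀ hα, map_one]
      simp only [h1, Finset.sum_const, Finset.card_univ, nsmul_eq_mul, mul_one]
    rw [this]
    exact Nat.cast_ne_zero.mpr Fintype.card_ne_zero
  · rw [← expEvalRingHom_apply, map_mul, hzev, zero_mul]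

/-- The **Lindemann–Weierstrass theorem**: exponentials of distinct algebraic numbers are linearly
independent over the algebraic numbers. -/
theorem lindemann_weierstrass {ι : Type*} (s : Finset ι) (a b : ι → ℂ)
    (hinj : Set.InjOn a s) (ha : ∀ i ∈ s, IsAlgebraic ℚ (a i)) (hb : ∀ i ∈ s, IsAlgebraic ℚ (b i))
    (hsum : ∑ i ∈ s, b i * Complex.exp (a i) = 0) : ∀ i ∈ s, b i = 0 := by
  classical
  set S : Set ℂ := ((s.image a ∪ s.image b : Finset ℂ) : Set ℂ) with hS
  have hSint : ∀ x ∈ S, IsIntegral ℚ x := by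
    intro x hx
    simp only [hS, Finset.coe_union, Finset.coe_image, Set.mem_union, Set.mem_image,
      Finset.mem_coe] at hx
    rcases hx with ⟨i, hi, rfl⟩ | ⟨i, hi, rfl⟩
    · exact (ha i hi).isIntegral
    · exact (hb i hi).isIntegral
  have : Finite S := Finset.finite_toSet _
  have : FiniteDimensional ℚ (IntermediateField.adjoin ℚ S) :=
    IntermediateField.finiteDimensional_adjoin hSint
  set L := IntermediateField.normalClosure ℚ (IntermediateField.adjoin ℚ S) ℂ with hL
  have : FiniteDimensional ℚ L := normalClosure.is_finiteDimensional _ _ _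
  have : NumberField L := { to_charZero := inferInstance, to_finiteDimensional := inferInstance }
  have : IsNormalClosure ℚ (IntermediateField.adjoin ℚ S) L :=
    Algebra.IsAlgebraic.isNormalClosure_normalClosure fun _ => IsAlgClosed.splits _
  have : Normal ℚ L := IsNormalClosure.normal (K := IntermediateField.adjoin ℚ S)
  have : IsGalois ℚ L := {}
  have hle : IntermediateField.adjoin ℚ S ≤ L := IntermediateField.le_normalClosure _
  have hmem : ∀ x ∈ S, x ∈ L := fun x hx => hle (IntermediateField.subset_adjoin ℚ S hx)
  have haL : ∀ i ∈ s, a i ∈ L := fun i hi => hmem _ (by simp [hS]; exact Or.inl ⟨i, hi, rfl⟩)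
  have hbL : ∀ i ∈ s, b i ∈ L := fun i hi => hmem _ (by simp [hS]; exact Or.inr ⟨i, hi, rfl⟩)
  let x : AddMonoidAlgebra L L :=
    ∑ i ∈ s.attach, AddMonoidAlgebra.single ⟨a i, haL i i.2⟩ ⟨b i, hbL i i.2⟩
  have hx : x = 0 := by
    refine expEvalRingHom_injective (algebraMap L ℂ) ?_
    rw [map_zero, map_sum, ← hsum, ← Finset.sum_attach s]
    exact Finset.sum_congr rfl fun i _ => expEvalRingHom_single _ _ _
  intro i hi
  have h := congrArg (fun y : AddMonoidAlgebra L L => y.coeff ⟨a i, haL i hi⟩) hx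
  simp only [x, AddMonoidAlgebra.coeff_sum, Finsupp.finsetSum_apply,
    AddMonoidAlgebra.coeff_single, AddMonoidAlgebra.coeff_zero, Finsupp.coe_zero,
    Pi.zero_apply] at h
  rw [Finset.sum_eq_single ⟨i, hi⟩, Finsupp.single_eq_same] at h
  · exact congrArg Subtype.val h
  · intro j _ hj
    refine Finsupp.single_eq_of_ne fun h' => hj ?_
    exact Subtype.ext (hinj j.2 hi (congrArg Subtype.val h').symm)
  · intro h'
    exact absurd (Finset.mem_attach _ _) h'

end LindemannWeierstrass

section AnalyticZeros

open Filter Topology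

theorem AnalyticAt.eventually_eq_zero_of_iteratedFDeriv_eq_zero {E : Type*}
    [NormedAddCommGroup E] [NormedSpace ℝ E] {f : E → ℝ} {y : E} (hf : AnalyticAt ℝ f y)
    (h : ∀ k, iteratedFDeriv ℝ k f y = 0) : f =ᶠ[𝓝 y] 0 := by
  obtain ⟨p, r, hp⟩ := hf
  have hball : Metric.eball y r ∈ 𝓝 y := Metric.eball_mem_nhds y hp.r_pos
  filter_upwards [hball] with x hx
  have hx' : x - y ∈ Metric.eball (0 : E) r := by
    simpa [Metric.mem_eball, edist_eq_enorm_sub] using hx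
  have hs := hp.hasSum_iteratedFDeriv hx'
  simp only [h] at hs
  simpa using hs.unique (by simp)

/-- Analytic implicit function theorem for a hypersurface in coordinate space: near a regular
point, the zero set of `g` is contained in a graph over a coordinate hyperplane. -/
theorem AnalyticAt.exists_graph_of_fderiv_ne_zero {m : ℕ} {g : (Fin (m + 1) → ℝ) → ℝ}
    {y : Fin (m + 1) → ℝ} (hg : AnalyticAt ℝ g y) (hgy : g y = 0) (hg' : fderiv ℝ g y ≠ 0) :
    ∃ (i : Fin (m + 1)) (γ : (Fin m → ℝ) → (Fin (m + 1) → ℝ)),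
      AnalyticAt ℝ γ (i.removeNth y) ∧ γ (i.removeNth y) = y ∧
      (∀ᶠ z in 𝓝 (i.removeNth y), i.removeNth (γ z) = z) ∧
      (∀ᶠ x in 𝓝 y, g x = 0 → γ (i.removeNth x) = x) := by
  obtain ⟨i, hi⟩ : ∃ i, fderiv ℝ g y (Pi.single i 1) ≠ 0 := by
    by_contra! h
    apply hg'
    refine ContinuousLinearMap.coe_injective ((Pi.basisFun ℝ (Fin (m + 1))).ext fun i => ?_)
    simpa using h i
  set L := fderiv ℝ g y with hL
  let Φ : (Fin (m + 1) → ℝ) → (Fin (m + 1) → ℝ) := fun x => x + (g x - x i) • Pi.single i 1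
  let D : (Fin (m + 1) → ℝ) →L[ℝ] (Fin (m + 1) → ℝ) :=
    ContinuousLinearMap.id ℝ _ + (L - ContinuousLinearMap.proj i).smulRight (Pi.single i 1)
  have hD : HasFDerivAt Φ D y := by
    have h1 : HasFDerivAt (fun x : Fin (m + 1) → ℝ => g x - x i)
        (L - ContinuousLinearMap.proj i) y :=
      hg.differentiableAt.hasFDerivAt.sub (hasFDerivAt_apply i y)
    exact (hasFDerivAt_id y).add (h1.smul_const _)
  have hDinj : Function.Injective D := by
    rw [injective_iff_map_eq_zero]
    intro v hv
    have hv' : ∀ j, v j + (L v - v i) * (Pi.single i 1 : Fin (m + 1) → ℝ) j = 0 := by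
      intro j
      simpa [D] using congrFun hv j
    have h1 : L v = 0 := by simpa using hv' i
    have h2 : ∀ j, j ≠ i → v j = 0 := by
      intro j hj
      simpa [hj] using hv' j
    have h3 : v = v i • (Pi.single i 1 : Fin (m + 1) → ℝ) := by
      ext j
      by_cases hj : j = i
      · subst hj; simp
      · simp [hj, h2 j hj]
    rw [h3, map_smul, smul_eq_mul] at h1
    have h4 : v i = 0 := by
      rcases mul_eq_zero.mp h1 with h | h
      · exact h
      · exact absurd h hi
    rw [h3, h4, zero_smul]
  let e : (Fin (m + 1) → ℝ) ≃L[ℝ] (Fin (m + 1) → ℝ) :=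
    (LinearEquiv.ofInjectiveEndo (D : _ →ₗ[ℝ] _) hDinj).toContinuousLinearEquiv
  have he : (e : (Fin (m + 1) → ℝ) →L[ℝ] (Fin (m + 1) → ℝ)) = D := by
    ext1 v
    rfl
  have hΦ : AnalyticAt ℝ Φ y := by
    have : AnalyticAt ℝ (fun x : Fin (m + 1) → ℝ => x i) y :=
      (ContinuousLinearMap.proj (R := ℝ) (φ := fun _ : Fin (m + 1) => ℝ) i).analyticAt y
    exact analyticAt_id.add ((hg.sub this).smul analyticAt_const)
  have hΦc : ContDiffAt ℝ ⊤ Φ y := hΦ.contDiffAt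
  rw [← he] at hD
  have hΦy : Φ y = i.insertNth 0 (i.removeNth y) := by
    ext j
    refine Fin.succAboveCases i ?_ (fun j => ?_) j
    · simp [Φ, hgy]
    · simp [Φ, Fin.removeNth]
  have hrem : ∀ x, i.removeNth (Φ x) = i.removeNth x := by
    intro x
    ext j
    simp [Φ, Fin.removeNth]
  have hΦi : ∀ x, g x = 0 → Φ x = i.insertNth 0 (i.removeNth x) := by
    intro x hx
    ext j
    refine Fin.succAboveCases i ?_ (fun j => ?_) j
    · simp [Φ, hx]
    · simp [Φ, Fin.removeNth]
  have hn : (⊤ : WithTop ℕ∞) ≠ 0 := by simp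
  let Ψ := hΦc.localInverse hD hn
  have hΨa : AnalyticAt ℝ Ψ (Φ y) := by
    have := hΦc.to_localInverse hD hn
    exact this.analyticAt
  have hins : AnalyticAt ℝ (fun z : Fin m → ℝ => (i.insertNth 0 z : Fin (m + 1) → ℝ))
      (i.removeNth y) := by
    rw [analyticAt_pi_iff]
    intro j
    refine Fin.succAboveCases i ?_ (fun j => ?_) j
    · simpa using analyticAt_const
    · simp only [Fin.insertNth_apply_succAbove]
      exact (ContinuousLinearMap.proj (R := ℝ) (φ := fun _ : Fin m => ℝ) j).analyticAt _
  refine ⟨i, fun z => Ψ (i.insertNth 0 z), ?_, ?_, ?_, ?_⟩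
  · rw [hΦy] at hΨa
    exact hΨa.comp hins
  · change Ψ (i.insertNth 0 (i.removeNth y)) = y
    rw [← hΦy]
    exact hΦc.localInverse_apply_image hD hn
  · have h1 : ∀ᶠ w in 𝓝 (Φ y), Φ (Ψ w) = w :=
      (hΦc.hasStrictFDerivAt' hD hn).eventually_right_inverse
    rw [hΦy] at h1
    have h2 := hins.continuousAt.eventually h1
    filter_upwards [h2] with z hz
    rw [← hrem, hz, Fin.removeNth_insertNth]
  · have h1 : ∀ᶠ x in 𝓝 y, Ψ (Φ x) = x :=
      (hΦc.hasStrictFDerivAt' hD hn).eventually_left_inverse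
    filter_upwards [h1] with x hx hgx
    rw [← hΦi x hgx, hx]

/-- The points where the `k`-th derivative of `f` vanishes but the next one does not. -/
def vanishStratum {E : Type*} [NormedAddCommGroup E] [NormedSpace ℝ E] (f : E → ℝ) (k : ℕ) :
    Set E :=
  {x | iteratedFDeriv ℝ k f x = 0 ∧ iteratedFDeriv ℝ (k + 1) f x ≠ 0}

theorem AnalyticAt.exists_mem_vanishStratum {E : Type*} [NormedAddCommGroup E] [NormedSpace ℝ E]
    {f : E → ℝ} {y : E} (hf : AnalyticAt ℝ f y) (hy : f y = 0) (h : ¬ f =ᶠ[𝓝 y] 0) :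
    ∃ k, y ∈ vanishStratum f k := by
  by_contra! hk
  apply h
  refine hf.eventually_eq_zero_of_iteratedFDeriv_eq_zero fun k => ?_
  induction k with
  | zero => ext v; simp [hy]
  | succ k ih =>
    by_contra h1
    exact hk k ⟨ih, h1⟩

theorem exists_graph_of_mem_vanishStratum {m : ℕ} {f : (Fin (m + 1) → ℝ) → ℝ}
    {y : Fin (m + 1) → ℝ} {k : ℕ} (hf : AnalyticAt ℝ f y) (hy : y ∈ vanishStratum f k) :
    ∃ (i : Fin (m + 1)) (γ : (Fin m → ℝ) → (Fin (m + 1) → ℝ)),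
      AnalyticAt ℝ γ (i.removeNth y) ∧ γ (i.removeNth y) = y ∧
      (∀ᶠ z in 𝓝 (i.removeNth y), i.removeNth (γ z) = z) ∧
      (∀ᶠ x in 𝓝 y, x ∈ vanishStratum f k → γ (i.removeNth x) = x) := by
  obtain ⟨hy1, hy2⟩ := hy
  have hder : AnalyticAt ℝ (iteratedFDeriv ℝ k f) y := by
    have h1 := hf.eventually_analyticAt
    obtain ⟨s, hs, hso, hys⟩ := eventually_nhds_iff.mp h1
    exact AnalyticOnNhd.iteratedFDeriv (s := s) (fun x hx => hs x hx) k y hys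
  obtain ⟨v, hv⟩ : ∃ v, iteratedFDeriv ℝ (k + 1) f y v ≠ 0 := by
    by_contra! h
    exact hy2 (by ext v; simpa using h v)
  let ev : ContinuousMultilinearMap ℝ (fun _ : Fin k => Fin (m + 1) → ℝ) ℝ →L[ℝ] ℝ :=
    ContinuousMultilinearMap.apply ℝ (fun _ : Fin k => Fin (m + 1) → ℝ) ℝ (Fin.tail v)
  have hg : AnalyticAt ℝ (fun x => ev (iteratedFDeriv ℝ k f x)) y :=
    (ev.analyticAt _).comp hder
  have hgy : ev (iteratedFDeriv ℝ k f y) = 0 := by rw [hy1, map_zero]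
  have hfd : fderiv ℝ (fun x => ev (iteratedFDeriv ℝ k f x)) y ≠ 0 := by
    intro h0
    apply hv
    rw [iteratedFDeriv_succ_apply_left]
    have h2 : HasFDerivAt (fun x => ev (iteratedFDeriv ℝ k f x))
        (ev.comp (fderiv ℝ (iteratedFDeriv ℝ k f) y)) y :=
      ev.hasFDerivAt.comp y hder.differentiableAt.hasFDerivAt
    rw [h2.fderiv] at h0
    exact DFunLike.congr_fun h0 (v 0)
  obtain ⟨i, γ, h1, h2, h3, h4⟩ := hg.exists_graph_of_fderiv_ne_zero hgy hfd
  refine ⟨i, γ, h1, h2, h3, ?_⟩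
  filter_upwards [h4] with x hx hxs
  exact hx (by rw [hxs.1, map_zero])

theorem dimH_image_le_of_analyticOnNhd {m l : ℕ} {γ : (Fin m → ℝ) → (Fin l → ℝ)}
    {z : Fin m → ℝ} {r : ℝ} (hγ : AnalyticOnNhd ℝ γ (Metric.ball z r)) {t : Set (Fin m → ℝ)}
    (ht : t ⊆ Metric.ball z r) : dimH (γ '' t) ≤ dimH t :=
  ContDiffOn.dimH_image_le (fun w hw => (hγ w hw).contDiffAt.contDiffWithinAt)
    (convex_ball z r) ht

theorem dimH_le_natCast {m : ℕ} (t : Set (Fin m → ℝ)) : dimH t ≤ m :=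
  (dimH_mono (subset_univ t)).trans (Real.dimH_univ_pi_fin m).le

theorem dimH_inter_vanishStratum_le {m : ℕ} {f : (Fin (m + 1) → ℝ) → ℝ}
    {U : Set (Fin (m + 1) → ℝ)} (hf : AnalyticOnNhd ℝ f U) (k : ℕ) :
    dimH (U ∩ vanishStratum f k) ≤ m := by
  by_contra! hlt
  obtain ⟨x, hx, hxt⟩ := exists_mem_nhdsWithin_lt_dimH_of_lt_dimH hlt
  obtain ⟨i, γ, h1, -, -, h4⟩ := exists_graph_of_mem_vanishStratum (hf x hx.1) hx.2
  obtain ⟨r, hr, hball⟩ := Metric.eventually_nhds_iff_ball.mp h1.eventually_analyticAt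
  have hcont : Continuous fun x : Fin (m + 1) → ℝ => i.removeNth x :=
    continuous_pi fun j => continuous_apply _
  have h5 : ∀ᶠ x' in 𝓝 x, (i.removeNth x' : Fin _ → ℝ) ∈ Metric.ball (i.removeNth x) r :=
    hcont.continuousAt.eventually (Metric.ball_mem_nhds _ hr)
  have h6 := hxt (_ ∩ (U ∩ vanishStratum f k))
    (inter_mem (mem_nhdsWithin_of_mem_nhds (h4.and h5)) self_mem_nhdsWithin)
  refine absurd h6 (not_lt.mpr ?_)
  calc _ ≤ dimH (γ '' Metric.ball (i.removeNth x) r) := by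
        refine dimH_mono ?_
        rintro w ⟨⟨hw1, hw2⟩, hw3⟩
        exact ⟨_, hw2, hw1 hw3.2⟩
    _ ≤ dimH (Metric.ball (i.removeNth x) r) :=
        dimH_image_le_of_analyticOnNhd (fun w hw => hball w hw) subset_rfl
    _ ≤ m := dimH_le_natCast _

theorem AnalyticOnNhd.inter_zeros_subset_iUnion_vanishStratum {E : Type*} [NormedAddCommGroup E]
    [NormedSpace ℝ E] {f : E → ℝ} {U : Set E} (hf : AnalyticOnNhd ℝ f U) (hU : IsPreconnected U)
    (h : ∃ x ∈ U, f x ≠ 0) : U ∩ {x | f x = 0} ⊆ ⋃ k, U ∩ vanishStratum f k := by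
  rintro x ⟨hxU, hx⟩
  obtain ⟨w, hw, hfw⟩ := h
  obtain ⟨k, hk⟩ := (hf x hxU).exists_mem_vanishStratum hx fun h0 =>
    hfw (hf.eqOn_zero_of_preconnected_of_eventuallyEq_zero hU hxU h0 hw)
  exact mem_iUnion.mpr ⟨k, hxU, hk⟩

theorem AnalyticOnNhd.dimH_zeros_le {m : ℕ} {f : (Fin (m + 1) → ℝ) → ℝ}
    {U : Set (Fin (m + 1) → ℝ)} (hf : AnalyticOnNhd ℝ f U) (hU : IsPreconnected U)
    (h : ∃ x ∈ U, f x ≠ 0) : dimH (U ∩ {x | f x = 0}) ≤ m := by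
  refine (dimH_mono (hf.inter_zeros_subset_iUnion_vanishStratum hU h)).trans ?_
  rw [dimH_iUnion]
  exact iSup_le fun k => dimH_inter_vanishStratum_le hf k

/-- A nonzero analytic function whose zero set has codimension one in an open set vanishes there
on the graph of a continuous function over a ball in some coordinate hyperplane. -/
theorem exists_graph_subset_zeros {m : ℕ} {f : (Fin (m + 1) → ℝ) → ℝ}
    (hf : AnalyticOnNhd ℝ f univ) (hne : ∃ x, f x ≠ 0) {U : Set (Fin (m + 1) → ℝ)}
    (hU : IsOpen U) (hnon : (U ∩ {x | f x = 0}).Nonempty)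
    (hdim : (m : ℝ≥0∞) ≤ dimH (U ∩ {x | f x = 0})) :
    ∃ (i : Fin (m + 1)) (γ : (Fin m → ℝ) → (Fin (m + 1) → ℝ)) (z : Fin m → ℝ) (r : ℝ), 0 < r ∧
      ContinuousOn γ (Metric.ball z r) ∧
      ∀ w ∈ Metric.ball z r, i.removeNth (γ w) = w ∧ γ w ∈ U ∧ f (γ w) = 0 := by
  cases m with
  | zero =>
    obtain ⟨y, hyU, hy⟩ := hnon
    exact ⟨0, fun _ => y, 0, 1, one_pos, continuousOn_const,
      fun w _ => ⟨Subsingleton.elim _ _, hyU, hy⟩⟩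
  | succ k =>
    have hsub := hf.inter_zeros_subset_iUnion_vanishStratum isPreconnected_univ (by simpa using hne)
    have hlt : (k : ℝ≥0∞) < dimH (U ∩ {x | f x = 0}) :=
      lt_of_lt_of_le (by exact_mod_cast Nat.lt_succ_self k) hdim
    obtain ⟨j, hj⟩ : ∃ j, (k : ℝ≥0∞) < dimH ((U ∩ {x | f x = 0}) ∩ vanishStratum f j) := by
      by_contra! hall
      refine absurd hlt (not_lt.mpr ?_)
      calc _ ≤ dimH (⋃ j, (U ∩ {x | f x = 0}) ∩ vanishStratum f j) := by
            refine dimH_mono fun x hx => ?_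
            obtain ⟨j, hj⟩ := mem_iUnion.mp (hsub ⟨mem_univ x, hx.2⟩)
            exact mem_iUnion.mpr ⟨j, hx, hj.2⟩
        _ ≤ k := by
            rw [dimH_iUnion]
            exact iSup_le hall
    have hj' : ((k : NNReal) : ℝ≥0∞) < dimH ((U ∩ {x | f x = 0}) ∩ vanishStratum f j) := by
      simpa using hj
    obtain ⟨x, hx, hxt⟩ := exists_mem_nhdsWithin_lt_dimH_of_lt_dimH hj'
    obtain ⟨i, γ, h1, h2, h3, h4⟩ := exists_graph_of_mem_vanishStratum (hf x (mem_univ x)) hx.2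
    have hγU : ∀ᶠ w in 𝓝 (i.removeNth x), γ w ∈ U :=
      h1.continuousAt.eventually (by rw [h2]; exact hU.mem_nhds hx.1.1)
    obtain ⟨r, hr, hball⟩ := Metric.eventually_nhds_iff_ball.mp
      (h1.eventually_analyticAt.and (h3.and hγU))
    have hγa : AnalyticOnNhd ℝ γ (Metric.ball (i.removeNth x) r) := fun w hw => (hball w hw).1
    refine ⟨i, γ, i.removeNth x, r, hr, hγa.continuousOn, fun w hw =>
      ⟨(hball w hw).2.1, (hball w hw).2.2, ?_⟩⟩
    by_contra hfw
    have hfγ : AnalyticOnNhd ℝ (f ∘ γ) (Metric.ball (i.removeNth x) r) :=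
      hf.comp hγa (mapsTo_univ _ _)
    have hdimle := hfγ.dimH_zeros_le (convex_ball _ r).isPreconnected ⟨w, hw, hfw⟩
    have hcont : Continuous fun x : Fin (k + 1 + 1) → ℝ => i.removeNth x :=
      continuous_pi fun j => continuous_apply _
    have h5 : ∀ᶠ x' in 𝓝 x, (i.removeNth x' : Fin _ → ℝ) ∈ Metric.ball (i.removeNth x) r :=
      hcont.continuousAt.eventually (Metric.ball_mem_nhds _ hr)
    have h6 := hxt (_ ∩ ((U ∩ {x | f x = 0}) ∩ vanishStratum f j))
      (inter_mem (mem_nhdsWithin_of_mem_nhds (h4.and h5)) self_mem_nhdsWithin)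
    refine absurd h6 (not_lt.mpr ?_)
    calc _ ≤ dimH (γ '' (Metric.ball (i.removeNth x) r ∩ {w | (f ∘ γ) w = 0})) := by
          refine dimH_mono ?_
          rintro w ⟨⟨hw1, hw2⟩, hw3⟩
          refine ⟨_, ⟨hw2, ?_⟩, hw1 hw3.2⟩
          simpa [hw1 hw3.2] using hw3.1.2
      _ ≤ dimH (Metric.ball (i.removeNth x) r ∩ {w | (f ∘ γ) w = 0}) :=
          dimH_image_le_of_analyticOnNhd hγa inter_subset_left
      _ ≤ _ := by simpa using hdimle

theorem le_locDim_of_graph {m : ℕ} {A : Set (Fin (m + 1) → ℝ)} {i : Fin (m + 1)}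
    {γ : (Fin m → ℝ) → (Fin (m + 1) → ℝ)} {z : Fin m → ℝ} {r : ℝ}
    (hc : ContinuousOn γ (Metric.ball z r))
    (h : ∀ w ∈ Metric.ball z r, i.removeNth (γ w) = w ∧ γ w ∈ A) {w : Fin m → ℝ}
    (hw : w ∈ Metric.ball z r) : (m : ℝ≥0∞) ≤ locDim A (γ w) := by
  refine le_iInf₂ fun ε hε => ?_
  have hz : Metric.ball z r ∈ 𝓝 w := Metric.isOpen_ball.mem_nhds hw
  have hV : Metric.ball z r ∩ γ ⁻¹' Metric.ball (γ w) ε ∈ 𝓝 w :=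
    inter_mem hz ((hc.continuousAt hz) (Metric.ball_mem_nhds _ hε))
  have hlip : LipschitzWith 1 fun x : Fin (m + 1) → ℝ => (i.removeNth x : Fin m → ℝ) :=
    LipschitzWith.of_dist_le_mul fun x y => by
      simp only [NNReal.coe_one, one_mul]
      exact (dist_pi_le_iff dist_nonneg).mpr fun j => dist_le_pi_dist x y _
  calc (m : ℝ≥0∞) = dimH (Metric.ball z r ∩ γ ⁻¹' Metric.ball (γ w) ε) := by
        rw [Real.dimH_of_mem_nhds hV, Module.finrank_fin_fun]
    _ ≤ dimH ((fun x : Fin (m + 1) → ℝ => (i.removeNth x : Fin m → ℝ)) ''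
          (A ∩ Metric.ball (γ w) ε)) := by
        refine dimH_mono fun v hv => ⟨γ v, ⟨(h v hv.1).2, hv.2⟩, (h v hv.1).1⟩
    _ ≤ _ := hlip.dimH_image_le _

theorem locDim_le_dimH {n : ℕ} (A : Set (Fin n → ℝ)) (x : Fin n → ℝ) : locDim A x ≤ dimH A :=
  (iInf₂_le (1 : ℝ) one_pos).trans (dimH_mono inter_subset_left)

theorem locDim_le_dimH_inter_ball {n : ℕ} (A : Set (Fin n → ℝ)) (x : Fin n → ℝ) {ε : ℝ}
    (hε : 0 < ε) : locDim A x ≤ dimH (A ∩ Metric.ball x ε) :=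
  iInf₂_le ε hε

end AnalyticZeros

section AlgebraicPoints

open MvPolynomial

/-- A nonzero polynomial is not identically zero on some line parallel to a coordinate axis
through a rational point of a given ball. -/
theorem exists_rat_eval_insertNth_ne_zero {m : ℕ} {b : MvPolynomial (Fin (m + 1)) ℝ} (hb : b ≠ 0)
    (i : Fin (m + 1)) (z : Fin m → ℝ) {r : ℝ} (hr : 0 < r) :
    ∃ q : Fin m → ℚ, (fun j => (q j : ℝ)) ∈ Metric.ball z r ∧
      ∃ t : ℝ, eval (i.insertNth t fun j => (q j : ℝ)) b ≠ 0 := by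
  by_contra! hall
  apply hb
  let s : Fin (m + 1) → Set ℝ :=
    i.insertNth (α := fun _ => Set ℝ) univ
      fun j => Set.range ((↑) : ℚ → ℝ) ∩ Ioo (z j - r) (z j + r)
  refine funext_set s (fun j => ?_) fun x hx => ?_
  · refine Fin.succAboveCases i ?_ (fun j => ?_) j
    · simpa [s] using Set.infinite_univ
    · simp only [s, Fin.insertNth_apply_succAbove]
      intro hfin
      obtain ⟨c, hc1, hc2⟩ := exists_rat_btwn (show z j - r < z j + r by linarith)
      obtain ⟨d, hd1, hd2⟩ := exists_rat_btwn hc2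
      have hcd : c < d := by exact_mod_cast hd1
      refine (Ioo_infinite hcd) (Set.Finite.of_finite_image
        (Set.Finite.subset hfin ?_ : (((↑) : ℚ → ℝ) '' Ioo c d).Finite) Rat.cast_injective.injOn)
      rintro _ ⟨e, he, rfl⟩
      have h1 : (c : ℝ) < e := by exact_mod_cast he.1
      have h2 : (e : ℝ) < d := by exact_mod_cast he.2
      exact ⟨⟨e, rfl⟩, by linarith, by linarith⟩
  · have hx' : ∀ j, x (i.succAbove j) ∈ Set.range ((↑) : ℚ → ℝ) ∩ Ioo (z j - r) (z j + r) := by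
      intro j
      simpa [s] using hx (i.succAbove j) (mem_univ _)
    choose q hq using fun j => (hx' j).1
    have h1 : (fun j => (q j : ℝ)) ∈ Metric.ball z r := by
      rw [Metric.mem_ball, dist_pi_lt_iff hr]
      intro j
      rw [hq, ← Metric.mem_ball, Real.ball_eq_Ioo]
      exact (hx' j).2
    have h2 := hall q h1 (x i)
    have h3 : (i.insertNth (x i) fun j => (q j : ℝ)) = x := by
      ext j
      refine Fin.succAboveCases i ?_ (fun j => ?_) j
      · simp
      · simp [hq]
    rw [map_zero, ← h3]
    exact h2

/-- If a polynomial with algebraic coefficients vanishes at `p`, but not on the whole line through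
`p` in the `i`-th coordinate direction, and the other coordinates of `p` are algebraic, then so is
the `i`-th one. -/
theorem isAlgebraic_of_eval_eq_zero {m : ℕ} {b : MvPolynomial (Fin (m + 1)) ℝ}
    (hb : ∀ d, IsAlgebraic ℚ (b.coeff d)) {i : Fin (m + 1)} {p : Fin (m + 1) → ℝ}
    (hp : ∀ j, IsAlgebraic ℚ (p (i.succAbove j)))
    (hne : ∃ t : ℝ, eval (i.insertNth t (i.removeNth p)) b ≠ 0)
    (h0 : eval p b = 0) : IsAlgebraic ℚ (p i) := by
  let A := algebraicClosure ℚ ℝ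
  obtain ⟨b', hb'⟩ : b ∈ Set.range (MvPolynomial.map (algebraMap A ℝ)) := by
    rw [MvPolynomial.mem_range_map_iff_coeffs_subset]
    intro c hc
    obtain ⟨d, -, rfl⟩ := MvPolynomial.mem_coeffs_iff.mp hc
    exact ⟨⟨b.coeff d, (mem_algebraicClosure_iff').mpr (hb d).isIntegral⟩, rfl⟩
  let w : Fin m → A := fun j =>
    ⟨p (i.succAbove j), (mem_algebraicClosure_iff').mpr (hp j).isIntegral⟩
  let q : Polynomial A :=
    MvPolynomial.eval₂ Polynomial.C (i.insertNth Polynomial.X fun j => Polynomial.C (w j)) b'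
  have hq : ∀ t : ℝ, Polynomial.aeval t q = eval (i.insertNth t (i.removeNth p)) b := by
    intro t
    rw [← hb', MvPolynomial.eval_map]
    change (Polynomial.aeval t : Polynomial A →ₐ[A] ℝ).toRingHom _ = _
    rw [MvPolynomial.hom_eval₂]
    congr 1
    · ext a; simp
    · ext j
      refine Fin.succAboveCases i ?_ (fun j => ?_) j
      · simp
      · simp [w, Fin.removeNth]
  have hq0 : q ≠ 0 := by
    obtain ⟨t, ht⟩ := hne
    rintro h
    rw [← hq, h, map_zero] at ht
    exact ht rfl
  have halg : IsAlgebraic A (p i) := by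
    refine ⟨q, hq0, ?_⟩
    rw [hq, Fin.insertNth_self_removeNth, h0]
  have : Algebra.IsAlgebraic ℚ A := algebraicClosure.isAlgebraic ℚ ℝ
  exact halg.restrictScalars ℚ

end AlgebraicPoints

section ExponentialCoefficients

variable {n : ℕ}

/-- The exponent vectors of the `U`-monomials of `Q`, as a finite set. -/
def uexpsFinset (Q : MvPolynomial (Fin n ⊕ Fin n) ℝ) : Finset (Fin n → ℕ) :=
  Q.support.image fun m i => m (Sum.inr i)

theorem coe_uexpsFinset (Q : MvPolynomial (Fin n ⊕ Fin n) ℝ) :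
    (uexpsFinset Q : Set (Fin n → ℕ)) = Uexps Q := by
  simp [uexpsFinset, Uexps]

/-- The value at `x` of the coefficient of `U ^ d` in `Q`. -/
def uCoeff (Q : MvPolynomial (Fin n ⊕ Fin n) ℝ) (d : Fin n → ℕ) (x : Fin n → ℝ) : ℝ :=
  ∑ m ∈ Q.support with (fun i => m (Sum.inr i)) = d, Q.coeff m * ∏ i, x i ^ m (Sum.inl i)

theorem continuous_uCoeff (Q : MvPolynomial (Fin n ⊕ Fin n) ℝ) (d : Fin n → ℕ) :
    Continuous (uCoeff Q d) := by
  unfold uCoeff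
  fun_prop

theorem eval_sumElim_eq (Q : MvPolynomial (Fin n ⊕ Fin n) ℝ) (x u : Fin n → ℝ) :
    MvPolynomial.eval (Sum.elim x u) Q = ∑ d ∈ uexpsFinset Q, uCoeff Q d x * ∏ i, u i ^ d i := by
  rw [MvPolynomial.eval_eq', uexpsFinset,
    ← Finset.sum_fiberwise_of_maps_to (g := fun (m : (Fin n ⊕ Fin n) →₀ ℕ) i => m (Sum.inr i))
      fun m hm => Finset.mem_image_of_mem _ hm]
  refine Finset.sum_congr rfl fun d _ => ?_
  rw [uCoeff, Finset.sum_mul]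
  refine Finset.sum_congr rfl fun m hm => ?_
  rw [← (Finset.mem_filter.mp hm).2, Fintype.prod_sum_type, mul_assoc]
  simp

theorem expEval_eq (Q : MvPolynomial (Fin n ⊕ Fin n) ℝ) (x : Fin n → ℝ) :
    expEval Q x = ∑ d ∈ uexpsFinset Q, uCoeff Q d x * Real.exp (∑ i, (d i : ℝ) * x i) := by
  rw [expEval, eval_sumElim_eq]
  simp only [Real.exp_sum, ← Real.exp_nat_mul]

theorem isAlgebraic_coeff {σ : Type*} {K : Subfield ℝ} (hK : RealAlgExt K) {Q : MvPolynomial σ ℝ}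
    (hQ : CoeffsIn K Q) (m : σ →₀ ℕ) : IsAlgebraic ℚ (Q.coeff m) :=
  hK ⟨_, hQ m⟩

theorem isAlgebraic_natCast_mul {x : ℝ} (hx : IsAlgebraic ℚ x) (k : ℕ) :
    IsAlgebraic ℚ ((k : ℝ) * x) :=
  (isAlgebraic_natCast k).mul hx

theorem isAlgebraic_sum {ι : Type*} (s : Finset ι) (f : ι → ℝ)
    (hf : ∀ i ∈ s, IsAlgebraic ℚ (f i)) : IsAlgebraic ℚ (∑ i ∈ s, f i) :=
  Subalgebra.sum_mem (Subalgebra.algebraicClosure ℚ ℝ) hf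

theorem isAlgebraic_prod {ι : Type*} (s : Finset ι) (f : ι → ℝ)
    (hf : ∀ i ∈ s, IsAlgebraic ℚ (f i)) : IsAlgebraic ℚ (∏ i ∈ s, f i) :=
  Subalgebra.prod_mem (Subalgebra.algebraicClosure ℚ ℝ) hf

/-- At a zero of an E-polynomial with algebraic coordinates lying outside `WP Q`, all the
coefficients of the `U`-monomials of `Q` vanish, by the Lindemann–Weierstrass theorem. -/
theorem uCoeff_eq_zero_of_isAlgebraic {K : Subfield ℝ} (hK : RealAlgExt K)
    {Q : MvPolynomial (Fin n ⊕ Fin n) ℝ} (hQ : CoeffsIn K Q) {y : Fin n → ℝ}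
    (hy : ∀ i, IsAlgebraic ℚ (y i)) (hW : y ∉ WP Q) (h0 : expEval Q y = 0) :
    ∀ d ∈ uexpsFinset Q, uCoeff Q d y = 0 := by
  have hLW := lindemann_weierstrass (uexpsFinset Q)
    (fun d => ((∑ i, (d i : ℝ) * y i : ℝ) : ℂ)) (fun d => ((uCoeff Q d y : ℝ) : ℂ)) ?_ ?_ ?_ ?_
  · exact fun d hd => by exact_mod_cast hLW d hd
  · intro d hd e he hde
    by_contra hne
    rw [coe_uexpsFinset] at hd he
    exact hW ⟨d, e, hd, he, hne, Complex.ofReal_injective hde⟩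
  · intro d _
    exact (isAlgebraic_sum Finset.univ _ fun i _ =>
      isAlgebraic_natCast_mul (hy i) (d i)).algebraMap (A := ℂ)
  · intro d _
    exact (isAlgebraic_sum _ _ fun m _ => (isAlgebraic_coeff hK hQ m).mul
      (isAlgebraic_prod _ _ fun i _ => (hy i).pow _)).algebraMap (A := ℂ)
  · rw [expEval_eq] at h0
    exact_mod_cast h0

theorem isClosed_WP (Q : MvPolynomial (Fin n ⊕ Fin n) ℝ) : IsClosed (WP Q) := by
  have : WP Q = ⋃ d ∈ uexpsFinset Q, ⋃ e ∈ uexpsFinset Q, ⋃ _ : d ≠ e,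
      {x | ∑ i, (d i : ℝ) * x i = ∑ i, (e i : ℝ) * x i} := by
    ext x
    simp only [WP, ← coe_uexpsFinset, Finset.mem_coe, mem_ofPred_eq, mem_iUnion, exists_prop]
    tauto
  rw [this]
  refine (Finset.finite_toSet _).isClosed_biUnion fun d _ =>
    (Finset.finite_toSet _).isClosed_biUnion fun e _ => isClosed_iUnion_of_finite fun _ =>
      isClosed_eq (by fun_prop) (by fun_prop)

theorem analyticOnNhd_expEval (Q : MvPolynomial (Fin n ⊕ Fin n) ℝ) :
    AnalyticOnNhd ℝ (expEval Q) univ := by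
  intro x _
  have hcoord : ∀ i, AnalyticAt ℝ (fun x : Fin n → ℝ => x i) x := fun i =>
    (ContinuousLinearMap.proj (R := ℝ) (φ := fun _ : Fin n => ℝ) i).analyticAt x
  have : expEval Q = fun x => ∑ d ∈ Q.support, Q.coeff d *
      ((∏ i, x i ^ d (Sum.inl i)) * ∏ i, Real.exp (x i) ^ d (Sum.inr i)) := by
    ext x
    rw [expEval, MvPolynomial.eval_eq']
    simp [Fintype.prod_sum_type]
  rw [this]
  refine Finset.analyticAt_fun_sum _ fun d _ => analyticAt_const.mul ?_
  exact (Finset.analyticAt_fun_prod _ fun i _ => (hcoord i).pow _).mul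
    (Finset.analyticAt_fun_prod _ fun i _ => (hcoord i).rexp.pow _)

end ExponentialCoefficients

theorem eval_sumElim_eq_zero_of_mem_localSet {m : ℕ} {K : Subfield ℝ} (hK : RealAlgExt K)
    {S Q : MvPolynomial (Fin (m + 1) ⊕ Fin (m + 1)) ℝ} (hQ : CoeffsIn K Q)
    {T B A : Set (Fin (m + 1) → ℝ)} (hT : T = {x | expEval S x = 0})
    (hsub : T ⊆ {x | expEval Q x = 0}) (hdimT : dimH T = m) (hB : IsAlgSet K B)
    (hdimB : dimH B = m) (hTB : localSet T m ⊆ B) (hA : A ⊆ T \ WP Q) {x : Fin (m + 1) → ℝ}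
    (hx : x ∈ localSet A m) (u : Fin (m + 1) → ℝ) :
    MvPolynomial.eval (Sum.elim x u) Q = 0 := by
  have huniv : (m : ℝ≥0∞) < dimH (univ : Set (Fin (m + 1) → ℝ)) := by
    rw [Real.dimH_univ_pi_fin]
    exact_mod_cast Nat.lt_succ_self m
  have hne : ∃ x, expEval S x ≠ 0 := by
    by_contra! h
    rw [← hdimT, show T = univ by simp [hT, h]] at huniv
    exact lt_irrefl _ huniv
  obtain ⟨b, hbK, rfl⟩ := hB
  have hb : b ≠ 0 := by
    rintro rfl
    simp [Real.dimH_univ_pi_fin] at hdimB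
  suffices h : ∀ d ∈ uexpsFinset Q, uCoeff Q d x = 0 by
    rw [eval_sumElim_eq]
    exact Finset.sum_eq_zero fun d hd => by rw [h d hd, zero_mul]
  intro d hd
  have hcl : x ∈ closure {y | uCoeff Q d y = 0} := by
    rw [Metric.mem_closure_iff]
    intro ε hε
    have hUo : IsOpen (Metric.ball x ε \ WP Q) := Metric.isOpen_ball.sdiff (isClosed_WP Q)
    have hAU : A ∩ Metric.ball x ε ⊆ (Metric.ball x ε \ WP Q) ∩ {y | expEval S y = 0} := by
      rintro y ⟨hyA, hyx⟩
      refine ⟨⟨hyx, (hA hyA).2⟩, ?_⟩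
      rw [← hT]
      exact (hA hyA).1
    obtain ⟨i, γ, z, r, hr, hγc, hγ⟩ := exists_graph_subset_zeros (analyticOnNhd_expEval S) hne hUo
      ⟨x, hAU ⟨hx.1, Metric.mem_ball_self hε⟩⟩
      (hx.2.symm.le.trans ((locDim_le_dimH_inter_ball A x hε).trans (dimH_mono hAU)))
    have hγT : ∀ w ∈ Metric.ball z r, i.removeNth (γ w) = w ∧ γ w ∈ T := fun w hw =>
      ⟨(hγ w hw).1, by rw [hT]; exact (hγ w hw).2.2⟩
    obtain ⟨q, hq, hqb⟩ := exists_rat_eval_insertNth_ne_zero hb i z hr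
    set y := γ fun j => (q j : ℝ) with hy
    have hrem : i.removeNth y = fun j => (q j : ℝ) := (hγT _ hq).1
    have hyT : y ∈ T := (hγT _ hq).2
    have hyb : MvPolynomial.eval y b = 0 :=
      hTB ⟨hyT, le_antisymm ((locDim_le_dimH T y).trans hdimT.le) (le_locDim_of_graph hγc hγT hq)⟩
    have hyj : ∀ j, IsAlgebraic ℚ (y (i.succAbove j)) := fun j => by
      rw [show y (i.succAbove j) = q j from congrFun hrem j]
      exact isAlgebraic_algebraMap (q j)
    have hyi : IsAlgebraic ℚ (y i) :=
      isAlgebraic_of_eval_eq_zero (isAlgebraic_coeff hK hbK) hyj (by rwa [hrem]) hyb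
    have hyalg : ∀ j, IsAlgebraic ℚ (y j) := fun j => Fin.succAboveCases i hyi hyj j
    have hyU := (hγ _ hq).2.1
    exact ⟨y, uCoeff_eq_zero_of_isAlgebraic hK hQ hyalg hyU.2 (hsub hyT) d hd,
      by rw [dist_comm]; exact hyU.1⟩
  rwa [(isClosed_eq (continuous_uCoeff Q d) continuous_const).closure_eq] at hcl

/-- If `T = Z(E(S)) ⊆ Z(E(P))` has dimension `n-1` and its top-dimensional part lies in an
`(n-1)`-dimensional algebraic set over `𝕂`, then the top-dimensional parts of `T \ W_S`,
`T \ (W_P ∪ W_S)` and `(T ∩ W_S) \ W_P` times `ℝⁿ` lie in `Z(S)`, `Z(P) ∩ Z(S)`, `Z(P)`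
respectively. -/
theorem stmt13 (n : ℕ) (K : Subfield ℝ) (hK : RealAlgExt K)
    (P S : MvPolynomial (Fin n ⊕ Fin n) ℝ) (hP : CoeffsIn K P) (hS : CoeffsIn K S)
    (T : Set (Fin n → ℝ)) (hTdef : T = {x | expEval S x = 0})
    (hsub : T ⊆ {x : Fin n → ℝ | expEval P x = 0})
    (hdimT : dimH T = ((n - 1 : ℕ) : ℝ≥0∞))
    (B : Set (Fin n → ℝ)) (hB : IsAlgSet K B) (hdimB : dimH B = ((n - 1 : ℕ) : ℝ≥0∞))
    (hTB : localSet T (n - 1) ⊆ B) :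
    (∀ x ∈ localSet (T \ WP S) (n - 1), ∀ u : Fin n → ℝ,
        MvPolynomial.eval (Sum.elim x u) S = 0) ∧
    (∀ x ∈ localSet (T \ (WP P ∪ WP S)) (n - 1), ∀ u : Fin n → ℝ,
        MvPolynomial.eval (Sum.elim x u) P = 0 ∧ MvPolynomial.eval (Sum.elim x u) S = 0) ∧
    (∀ x ∈ localSet ((T ∩ WP S) \ WP P) (n - 1), ∀ u : Fin n → ℝ,
        MvPolynomial.eval (Sum.elim x u) P = 0) := by
  cases n with
  | zero =>
    have hzero : ∀ Q : MvPolynomial (Fin 0 ⊕ Fin 0) ℝ, ∀ x u : Fin 0 → ℝ, expEval Q x = 0 →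
        MvPolynomial.eval (Sum.elim x u) Q = 0 := by
      intro Q x u h
      rwa [expEval, Subsingleton.elim (fun i => Real.exp (x i)) u] at h
    have hTS : ∀ x ∈ T, expEval S x = 0 := fun x hx => by rwa [hTdef] at hx
    exact ⟨fun x hx u => hzero S x u (hTS x hx.1.1),
      fun x hx u => ⟨hzero P x u (hsub hx.1.1), hzero S x u (hTS x hx.1.1)⟩,
      fun x hx u => hzero P x u (hsub hx.1.1.1)⟩
  | succ m =>
    rw [Nat.add_sub_cancel] at *
    refine ⟨fun x hx u => ?_, fun x hx u => ⟨?_, ?_⟩, fun x hx u => ?_⟩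
    · exact eval_sumElim_eq_zero_of_mem_localSet hK hS hTdef hTdef.le hdimT hB hdimB hTB
        subset_rfl hx u
    · exact eval_sumElim_eq_zero_of_mem_localSet hK hP hTdef hsub hdimT hB hdimB hTB
        (fun y hy => ⟨hy.1, fun h => hy.2 (Or.inl h)⟩) hx u
    · exact eval_sumElim_eq_zero_of_mem_localSet hK hS hTdef hTdef.le hdimT hB hdimB hTB
        (fun y hy => ⟨hy.1, fun h => hy.2 (Or.inr h)⟩) hx u
    · exact eval_sumElim_eq_zero_of_mem_localSet hK hP hTdef hsub hdimT hB hdimB hTB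
        (fun y hy => ⟨hy.1.1, hy.2⟩) hx u

end
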